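/- arXiv:2305.17612 — 2 statements merged into one kernel-verified Lean document; each statement's English description precedes it below -/
import Mathlib

section
/- Let X and Y be real locally convex Hausdorff topological vector spaces, F₁, F₂: X ⇉ Y set-valued mappings, and (x*, y*) ∈ X* × Y*. Then always (F₁+F₂)*(x*, y*) ≤ inf{F₁*(x₁*, y*) + F₂*(x₂*, y*) | x₁* + x₂* = x*}. If moreover one of the following holds: (a) F₁ and F₂ are convex, int(gph F₁) ≠ ∅, and int(dom F₁) ∩ dom F₂ ≠ ∅; (b) F₁ and F₂ are polyhedral convex and dom F₁ ∩ dom F₂ ≠ ∅; (c) X and Y are Banach spaces, F₁ and F₂ have closed convex graphs, and 0 ∈ sqri(dom F₁ − dom F₂); then equality holds, and the infimum is attained whenever (F₁+F₂)*(x*, y*) ∈ ℝ. -/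
open Pointwise

noncomputable section

variable {X Y : Type*} [NormedAddCommGroup X] [NormedSpace ℝ X]
  [NormedAddCommGroup Y] [NormedSpace ℝ Y]

/-- Fenchel conjugate of a set-valued mapping `F : X ⇉ Y`. -/
def svConj (F : X → Set Y) (xs : X →L[ℝ] ℝ) (ys : Y →L[ℝ] ℝ) : EReal :=
  sSup ((fun p : X × Y => ((xs p.1 + ys p.2 : ℝ) : EReal)) '' {p : X × Y | p.2 ∈ F p.1})

/-- Effective domain of a set-valued mapping. -/
def sdom (F : X → Set Y) : Set X := {x | (F x).Nonempty}

/-- A polyhedral convex set-valued mapping: the graph is a finite intersection of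
half-spaces determined by continuous linear functionals. -/
def IsPolyMap (F : X → Set Y) : Prop :=
  ∃ (m : ℕ) (a : Fin m → (X →L[ℝ] ℝ)) (c : Fin m → (Y →L[ℝ] ℝ)) (b : Fin m → ℝ),
    {p : X × Y | p.2 ∈ F p.1} = {p | ∀ i, a i p.1 + c i p.2 ≤ b i}

/-- The cone generated by a set: `cone A = {t • a | t ≥ 0, a ∈ A}`. -/
def coneGen {W : Type*} [AddCommGroup W] [Module ℝ W] (A : Set W) : Set W :=
  {x | ∃ t : ℝ, 0 ≤ t ∧ ∃ a ∈ A, x = t • a}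

/-- `0 ∈ sqri A`: `0 ∈ A` and the cone generated by `A` is a closed linear subspace. -/
def ZeroSqri {W : Type*} [NormedAddCommGroup W] [NormedSpace ℝ W] (A : Set W) : Prop :=
  (0 : W) ∈ A ∧ ∃ S : Submodule ℝ W, (S : Set W) = coneGen A ∧ IsClosed (S : Set W)

open Set Filter Topology

/-- Farkas' lemma for finitely many linear functionals on a real vector space. -/
theorem exists_nonneg_sum_eq_of_nonpos {W : Type*} [AddCommGroup W] [Module ℝ W] {m : ℕ}
    (f : Fin m → W →ₗ[ℝ] ℝ) (g : W →ₗ[ℝ] ℝ) (hg : ∀ x, (∀ i, f i x ≤ 0) → g x ≤ 0) :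
    ∃ l : Fin m → ℝ, (∀ i, 0 ≤ l i) ∧ ∀ x, g x = ∑ i, l i * f i x := by
  induction m generalizing g with
  | zero =>
    refine ⟨0, fun i => i.elim0, fun x => ?_⟩
    have h₁ := hg x fun i => i.elim0
    have h₂ := hg (-x) fun i => i.elim0
    rw [map_neg] at h₂
    simp only [Finset.univ_eq_empty, Finset.sum_empty]
    linarith
  | succ m ih =>
    by_cases h : ∀ x, (∀ i : Fin m, f i.castSucc x ≤ 0) → g x ≤ 0
    · obtain ⟨l, hl, hlg⟩ := ih (fun i => f i.castSucc) g h
      refine ⟨Fin.snoc l 0, fun i => ?_, fun x => ?_⟩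
      · refine Fin.lastCases ?_ (fun j => ?_) i
        · simp
        · simpa using hl j
      · simp [Fin.sum_univ_castSucc, hlg x]
    · push Not at h
      obtain ⟨x₀, hx₀, hgx₀⟩ := h
      set F := f (Fin.last m) with hF
      have hFx₀ : 0 < F x₀ := by
        by_contra! hle
        exact hgx₀.not_ge (hg x₀ fun i => Fin.lastCases hle hx₀ i)
      let P : W →ₗ[ℝ] W := LinearMap.id - ((F x₀)⁻¹ • F).smulRight x₀
      have hP : ∀ x, P x = x - ((F x₀)⁻¹ * F x) • x₀ := fun x => by simp [P]
      obtain ⟨l, hl, hlg⟩ := ih (fun i => f i.castSucc ∘ₗ P) (g ∘ₗ P) fun x hx => by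
        refine hg (P x) fun i => Fin.lastCases (le_of_eq ?_) hx i
        rw [← hF, hP, map_sub, map_smul, smul_eq_mul]
        field_simp
        ring
      refine ⟨Fin.snoc l ((F x₀)⁻¹ * (g x₀ - ∑ i, l i * f i.castSucc x₀)), fun i => ?_,
        fun x => ?_⟩
      · refine Fin.lastCases ?_ (fun j => ?_) i
        · rw [Fin.snoc_last]
          have : ∑ i, l i * f i.castSucc x₀ ≤ 0 :=
            Finset.sum_nonpos fun i _ => mul_nonpos_of_nonneg_of_nonpos (hl i) (hx₀ i)
          have := inv_pos.2 hFx₀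
          exact mul_nonneg this.le (by linarith)
        · simpa using hl j
      · have h := hlg x
        simp only [LinearMap.comp_apply, hP, map_sub, map_smul, smul_eq_mul, mul_sub,
          Finset.sum_sub_distrib] at h
        have hs : ∑ i, l i * ((F x₀)⁻¹ * F x * f i.castSucc x₀)
            = (F x₀)⁻¹ * F x * ∑ i, l i * f i.castSucc x₀ := by
          rw [Finset.mul_sum]
          exact Finset.sum_congr rfl fun i _ => by ring
        rw [hs] at h
        simp only [Fin.sum_univ_castSucc, Fin.snoc_castSucc, Fin.snoc_last, ← hF]
        linear_combination h

/-- Affine Farkas' lemma: a linear functional bounded above on a nonempty polyhedron is a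
nonnegative combination of the functionals defining it. -/
theorem exists_nonneg_sum_eq_of_le {W : Type*} [AddCommGroup W] [Module ℝ W] {m : ℕ}
    (f : Fin m → W →ₗ[ℝ] ℝ) (b : Fin m → ℝ) (g : W →ₗ[ℝ] ℝ) (r : ℝ)
    (hne : ∃ x, ∀ i, f i x ≤ b i) (hg : ∀ x, (∀ i, f i x ≤ b i) → g x ≤ r) :
    ∃ l : Fin m → ℝ, (∀ i, 0 ≤ l i) ∧ (∀ x, g x = ∑ i, l i * f i x) ∧ ∑ i, l i * b i ≤ r := by
  obtain ⟨x₀, hx₀⟩ := hne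
  let f' : Fin (m + 1) → W × ℝ →ₗ[ℝ] ℝ :=
    Fin.snoc (fun i => f i ∘ₗ LinearMap.fst ℝ W ℝ - b i • LinearMap.snd ℝ W ℝ)
      (-LinearMap.snd ℝ W ℝ)
  obtain ⟨l, hl, hlg⟩ := exists_nonneg_sum_eq_of_nonpos f'
    (g ∘ₗ LinearMap.fst ℝ W ℝ - r • LinearMap.snd ℝ W ℝ) fun p hp => by
      obtain ⟨x, t⟩ := p
      have ht : 0 ≤ t := by simpa [f'] using hp (Fin.last m)
      have hx : ∀ i, f i x ≤ b i * t := fun i => by simpa [f'] using hp i.castSucc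
      suffices g x ≤ r * t by simpa using this
      rcases ht.eq_or_lt with rfl | ht
      · rw [mul_zero]
        by_contra! hpos
        have h := hg (x₀ + ((r - g x₀ + 1) / g x) • x) fun i => by
          have h₁ : 0 ≤ (r - g x₀ + 1) / g x :=
            div_nonneg (by linarith [hg x₀ hx₀]) hpos.le
          have h₂ := mul_nonpos_of_nonneg_of_nonpos h₁ (by simpa using hx i)
          rw [map_add, map_smul, smul_eq_mul]
          linarith [hx₀ i]
        rw [map_add, map_smul, smul_eq_mul, div_mul_cancel₀ _ hpos.ne'] at h
        linarith
      · have h := hg (t⁻¹ • x) fun i => by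
          rw [map_smul, smul_eq_mul, inv_mul_le_iff₀ ht, mul_comm]
          exact hx i
        rwa [map_smul, smul_eq_mul, inv_mul_le_iff₀ ht, mul_comm] at h
  simp only [Fin.sum_univ_castSucc, f', Fin.snoc_castSucc, Fin.snoc_last] at hlg
  refine ⟨fun i => l i.castSucc, fun i => hl _, fun x => by simpa using hlg (x, 0), ?_⟩
  have h := hlg (0, 1)
  simp at h
  linarith [hl (Fin.last m)]

/-- Lagrange multipliers for a linear program on a convex set, under a boundedness condition on
the value function near zero relative to a subspace `S`. -/
theorem exists_multiplier_of_bounded_near_zero {E Z : Type*} [NormedAddCommGroup E]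
    [NormedSpace ℝ E] [AddCommGroup Z] [Module ℝ Z]
    (S : Submodule ℝ E) {C : Set Z} (hC : Convex ℝ C) (T : Z →ₗ[ℝ] E) (h : Z →ₗ[ℝ] ℝ)
    (hTS : ∀ z ∈ C, T z ∈ S) {r ε c : ℝ} (hr : ∀ z ∈ C, T z = 0 → h z ≤ r) (hε : 0 < ε)
    (hb : ∀ u ∈ S, ‖u‖ < ε → ∃ z ∈ C, T z = u ∧ c ≤ h z) :
    ∃ φ : E →L[ℝ] ℝ, ∀ z ∈ C, h z ≤ r + φ (T z) := by
  let K : Set (S × ℝ) := {p | ∃ z ∈ C, T z = p.1 ∧ p.2 ≤ h z}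
  have hK : Convex ℝ K := by
    rintro ⟨u, s⟩ ⟨z, hz, hzu, hzs⟩ ⟨v, t⟩ ⟨w, hw, hwv, hwt⟩ a b ha hb hab
    refine ⟨a • z + b • w, hC hz hw ha hb hab, ?_, ?_⟩
    · simp_all
    · simp only [Prod.snd_add, Prod.smul_snd, map_add, map_smul, smul_eq_mul]
      exact add_le_add (mul_le_mul_of_nonneg_left hzs ha) (mul_le_mul_of_nonneg_left hwt hb)
  have hU : Metric.ball (0 : S) ε ×ˢ Iio c ⊆ interior K := by
    refine interior_maximal ?_ (Metric.isOpen_ball.prod isOpen_Iio)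
    rintro ⟨u, t⟩ ⟨hu, ht⟩
    obtain ⟨z, hz, hzu, hcz⟩ := hb u u.2 (by simpa using hu)
    exact ⟨z, hz, hzu, (mem_Iio.1 ht).le.trans hcz⟩
  have hnot : ((0 : S), r) ∉ interior K := by
    intro hmem
    have hcont : Tendsto (fun t : ℝ => ((0 : S), t)) (𝓝 r) (𝓝 (0, r)) :=
      (by fun_prop : Continuous fun t : ℝ => ((0 : S), t)).tendsto r
    have hev : ∀ᶠ t in 𝓝[>] r, ((0 : S), t) ∈ K :=
      nhdsWithin_le_nhds (hcont (mem_interior_iff_mem_nhds.1 hmem))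
    obtain ⟨t, ⟨z, hz, hz0, htz⟩, hrt⟩ := (hev.and self_mem_nhdsWithin).exists
    exact (lt_of_lt_of_le (mem_Ioi.1 hrt) htz).not_ge (hr z hz (by simpa using hz0))
  obtain ⟨f, hf⟩ := geometric_hahn_banach_open_point hK.interior isOpen_interior hnot
  have hsplit : ∀ (u : S) (t : ℝ), f (u, t) = f (u, 0) + t * f (0, 1) := fun u t => by
    rw [← smul_eq_mul, ← map_smul, ← map_add]
    simp
  have hmem : ((0 : S), min c r - 1) ∈ interior K := by
    refine hU ⟨by simpa using hε, ?_⟩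
    have := min_le_left c r
    simp only [mem_Iio]
    linarith
  have hs : 0 < f (0, 1) := by
    have h₁ := hf _ hmem
    rw [hsplit 0 (min c r - 1), hsplit 0 r] at h₁
    have h₂ := min_le_right c r
    by_contra! hle
    nlinarith
  have hle : ∀ p ∈ K, f p ≤ f (0, r) := by
    intro p hp
    have hcl : p ∈ closure (interior K) := by
      rw [hK.closure_interior_eq_closure_of_nonempty_interior ⟨_, hmem⟩]
      exact subset_closure hp
    exact closure_minimal (fun q hq => (hf q hq).le)
      (isClosed_le f.continuous continuous_const) hcl
  obtain ⟨φ, hφ, -⟩ := _root_.exists_extension_norm_eq S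
    (-(f (0, 1))⁻¹ • f.comp (ContinuousLinearMap.inl ℝ S ℝ))
  refine ⟨φ, fun z hz => ?_⟩
  have h₁ := hle (⟨T z, hTS z hz⟩, h z) ⟨z, hz, rfl, le_rfl⟩
  have h₂ := hφ ⟨T z, hTS z hz⟩
  have h₀ : f ((0 : S), (0 : ℝ)) = 0 := map_zero f
  simp only [_root_.smul_apply, ContinuousLinearMap.comp_apply,
    ContinuousLinearMap.inl_apply, smul_eq_mul] at h₂
  rw [hsplit, hsplit 0 r, h₀, zero_add] at h₁
  rw [h₂]
  have h₃ : h z - r ≤ -(f (0, 1))⁻¹ * f (⟨T z, hTS z hz⟩, 0) := by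
    rw [neg_mul, ← mul_neg, le_inv_mul_iff₀ hs]
    linarith
  linarith

/-- A closed convex set contains the sums of dyadic convex series of its elements. -/
theorem Convex.mem_of_hasSum_dyadic {E : Type*} [NormedAddCommGroup E] [NormedSpace ℝ E]
    {D : Set E} (hD : Convex ℝ D) (hcl : IsClosed D) {z : ℕ → E} (hz : ∀ k, z k ∈ D) {w : E}
    (hw : HasSum (fun k => (1 / 2 : ℝ) ^ (k + 1) • z k) w) : w ∈ D := by
  have key : ∀ n, ∀ c ∈ D,
      ∑ k ∈ Finset.range n, (1 / 2 : ℝ) ^ (k + 1) • z k + (1 / 2 : ℝ) ^ n • c ∈ D := by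
    intro n
    induction n with
    | zero => intro c hc; simpa using hc
    | succ n ih =>
      intro c hc
      have h := ih ((1 / 2 : ℝ) • z n + (1 / 2 : ℝ) • c)
        (hD (hz n) hc (by norm_num) (by norm_num) (by norm_num))
      rwa [smul_add, smul_smul, smul_smul, ← pow_succ, ← add_assoc, ← Finset.sum_range_succ] at h
  have h₀ : Tendsto (fun n : ℕ => (1 / 2 : ℝ) ^ n • z 0) atTop (𝓝 0) := by
    simpa using (tendsto_pow_atTop_nhds_zero_of_lt_one (r := (1 / 2 : ℝ))
      (by norm_num) (by norm_num)).smul_const (z 0)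
  have hlim := hw.tendsto_sum_nat.add h₀
  rw [add_zero] at hlim
  exact hcl.mem_of_tendsto hlim (Eventually.of_forall fun n => key n _ (hz 0))

/-- If the closure of a set which is stable under dyadic convex series is a neighborhood of zero,
then so is the set itself. -/
theorem mem_nhds_zero_of_closure_mem_nhds {E : Type*} [NormedAddCommGroup E] [NormedSpace ℝ E]
    [CompleteSpace E] {A : Set E}
    (hA : ∀ a : ℕ → E, (∀ k, a k ∈ A) → ∀ w,
      HasSum (fun k => (1 / 2 : ℝ) ^ (k + 1) • a k) w → w ∈ A)
    (h : closure A ∈ 𝓝 (0 : E)) : A ∈ 𝓝 (0 : E) := by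
  obtain ⟨ε, hε, hball⟩ := Metric.mem_nhds_iff.1 h
  have hstep : ∀ v : E, ∃ a, ‖v‖ < ε → a ∈ A ∧ ‖(2 : ℝ) • (v - a)‖ < ε := by
    intro v
    by_cases hv : ‖v‖ < ε
    · obtain ⟨a, ha, hva⟩ := Metric.mem_closure_iff.1 (hball (by simpa using hv)) (ε / 2)
        (half_pos hε)
      refine ⟨a, fun _ => ⟨ha, ?_⟩⟩
      rw [dist_eq_norm] at hva
      rw [norm_smul, Real.norm_ofNat]
      linarith
    · exact ⟨0, fun h => absurd h hv⟩
  choose a ha using hstep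
  refine Metric.mem_nhds_iff.2 ⟨ε / 2, half_pos hε, fun u hu => ?_⟩
  let v : ℕ → E := fun k => (fun v => (2 : ℝ) • (v - a v))^[k] ((2 : ℝ) • u)
  have hv₀ : v 0 = (2 : ℝ) • u := rfl
  have hvs : ∀ k, v (k + 1) = (2 : ℝ) • (v k - a (v k)) := fun k =>
    Function.iterate_succ_apply' _ _ _
  have hvε : ∀ k, ‖v k‖ < ε := by
    intro k
    induction k with
    | zero =>
      rw [hv₀, norm_smul, Real.norm_ofNat]
      have : ‖u‖ < ε / 2 := by simpa using hu
      linarith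
    | succ k ih => rw [hvs]; exact (ha _ ih).2
  have hav : ∀ k, a (v k) = v k - (1 / 2 : ℝ) • v (k + 1) := fun k => by
    rw [hvs, smul_smul]; norm_num
  have hpart : ∀ n, ∑ k ∈ Finset.range n, (1 / 2 : ℝ) ^ (k + 1) • a (v k)
      = u - (1 / 2 : ℝ) ^ (n + 1) • v n := by
    intro n
    induction n with
    | zero => rw [hv₀, smul_smul]; norm_num
    | succ n ih =>
      rw [Finset.sum_range_succ, ih, hav, smul_sub, smul_smul, ← pow_succ]
      abel
  have hsum : Summable fun k => (1 / 2 : ℝ) ^ (k + 1) • a (v k) := by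
    refine Summable.of_norm_bounded (g := fun k => (1 / 2 : ℝ) ^ k * ε)
      (summable_geometric_two.mul_right ε) fun k => ?_
    have h₁ : ‖a (v k)‖ ≤ 2 * ε := by
      rw [hav]
      refine (norm_sub_le _ _).trans ?_
      rw [norm_smul]
      norm_num
      linarith [hvε k, hvε (k + 1)]
    rw [norm_smul, norm_pow, pow_succ]
    norm_num
    have : (0 : ℝ) < (1 / 2) ^ k := by positivity
    nlinarith
  refine hA (fun k => a (v k)) (fun k => (ha _ (hvε k)).1) u ?_
  rw [hsum.hasSum_iff_tendsto_nat]
  simp only [hpart]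
  have hlim : Tendsto (fun n : ℕ => (1 / 2 : ℝ) ^ (n + 1) • v n) atTop (𝓝 0) := by
    refine squeeze_zero_norm (a := fun n => (1 / 2 : ℝ) ^ (n + 1) * ε) (fun n => ?_) ?_
    · rw [norm_smul, norm_pow]
      norm_num
      exact (hvε n).le
    · have h := ((tendsto_pow_atTop_nhds_zero_of_lt_one (r := (1 / 2 : ℝ))
        (by norm_num) (by norm_num)).comp (tendsto_add_atTop_nat 1)).mul_const ε
      simpa using h
  simpa using hlim.const_sub u

/-- A monotone sequence of convex sets, stable under dyadic convex series and jointly absorbing a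
Banach space, contains a neighborhood of zero. -/
theorem exists_mem_nhds_zero_of_absorbing {E : Type*} [NormedAddCommGroup E] [NormedSpace ℝ E]
    [CompleteSpace E] {A : ℕ → Set E} (hmono : Monotone A) (hconv : ∀ n, Convex ℝ (A n))
    (hA : ∀ n, ∀ a : ℕ → E, (∀ k, a k ∈ A n) → ∀ w,
      HasSum (fun k => (1 / 2 : ℝ) ^ (k + 1) • a k) w → w ∈ A n)
    (habs : ∀ u, ∃ n : ℕ, ∃ a ∈ A n, u = (n + 1 : ℝ) • a) : ∃ n, A n ∈ 𝓝 (0 : E) := by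
  obtain ⟨n, w, hw⟩ : ∃ n, (interior (closure (A n))).Nonempty := by
    obtain ⟨n, hn⟩ := nonempty_interior_of_iUnion_of_closed
      (f := fun n : ℕ => (n + 1 : ℝ) • closure (A n))
      (fun n => isClosedMap_smul₀ (n + 1 : ℝ) _ isClosed_closure) (by
        refine eq_univ_of_forall fun u => ?_
        obtain ⟨n, a, ha, rfl⟩ := habs u
        exact mem_iUnion.2 ⟨n, smul_mem_smul_set (subset_closure ha)⟩)
    rw [interior_smul₀ (by positivity)] at hn
    exact ⟨n, smul_set_nonempty.1 hn⟩
  obtain ⟨m, a, ha, hwa⟩ := habs (-w)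
  refine ⟨max n m, mem_nhds_zero_of_closure_mem_nhds (hA _) ?_⟩
  have hw' : w ∈ interior (closure (A (max n m))) :=
    interior_mono (closure_mono (hmono (le_max_left n m))) hw
  have ha' : a ∈ closure (closure (A (max n m))) :=
    subset_closure (subset_closure (hmono (le_max_right n m) ha))
  have h := (hconv (max n m)).closure.combo_interior_closure_subset_interior
    (a := 1 / (m + 2 : ℝ)) (b := (m + 1) / (m + 2 : ℝ)) (by positivity) (by positivity)
    (by field_simp; ring) (add_mem_add (smul_mem_smul_set hw') (smul_mem_smul_set ha'))
  have h0 : (1 / (m + 2 : ℝ)) • w + ((m + 1) / (m + 2 : ℝ)) • a = 0 := by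
    rw [show ((m + 1) / (m + 2 : ℝ)) = 1 / (m + 2 : ℝ) * (m + 1) by ring, mul_smul, ← hwa]
    simp
  rw [h0] at h
  exact mem_interior_iff_mem_nhds.1 h

/-- A Robinson-Ursescu type theorem: if the cone generated by the image of a closed convex set `C`
under a continuous linear map is a closed subspace `S`, then points of `S` near zero have
uniformly bounded preimages in `C`. -/
theorem exists_bounded_preimage {E Z : Type*} [NormedAddCommGroup E] [NormedSpace ℝ E]
    [CompleteSpace E] [NormedAddCommGroup Z] [NormedSpace ℝ Z] [CompleteSpace Z]
    {S : Submodule ℝ E} (hS : IsClosed (S : Set E)) {C : Set Z} (hC : Convex ℝ C)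
    (hCcl : IsClosed C) (T : Z →L[ℝ] E) (h0 : (0 : E) ∈ T '' C)
    (hcone : (S : Set E) = coneGen (T '' C)) :
    ∃ n : ℕ, ∃ ε > 0, ∀ u ∈ S, ‖u‖ < ε → ∃ z ∈ C, ‖z‖ ≤ n ∧ T z = u := by
  have : CompleteSpace S := hS.completeSpace_coe
  let A : ℕ → Set S := fun n => {u | ∃ z ∈ C ∩ Metric.closedBall 0 n, T z = u}
  have hD : ∀ n : ℕ, Convex ℝ (C ∩ Metric.closedBall 0 n) := fun n =>
    hC.inter (convex_closedBall _ _)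
  obtain ⟨n, hn⟩ : ∃ n, A n ∈ 𝓝 (0 : S) := by
    refine exists_mem_nhds_zero_of_absorbing ?_ ?_ ?_ ?_
    · rintro n m hnm u ⟨z, ⟨hz, hzn⟩, hzu⟩
      exact ⟨z, ⟨hz, Metric.closedBall_subset_closedBall (by exact_mod_cast hnm) hzn⟩, hzu⟩
    · rintro n u ⟨z, hz, hzu⟩ v ⟨w, hw, hwv⟩ a b ha hb hab
      exact ⟨a • z + b • w, hD n hz hw ha hb hab, by simp [hzu, hwv]⟩
    · intro n a ha w hw
      choose z hz hza using ha
      have hsum : Summable fun k => (1 / 2 : ℝ) ^ (k + 1) • z k := by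
        refine Summable.of_norm_bounded (g := fun k => (1 / 2 : ℝ) ^ k * n)
          (summable_geometric_two.mul_right _) fun k => ?_
        have h₁ : ‖z k‖ ≤ n := by simpa using (hz k).2
        rw [norm_smul, norm_pow]
        refine mul_le_mul ?_ h₁ (norm_nonneg _) (by positivity)
        rw [pow_succ]
        norm_num
      refine ⟨_, (hD n).mem_of_hasSum_dyadic (hCcl.inter Metric.isClosed_closedBall) hz
        hsum.hasSum, ?_⟩
      have h₁ := hsum.hasSum.mapL T
      have h₂ := hw.mapL S.subtypeL
      simp only [map_smul, Submodule.subtypeL_apply, hza] at h₁ h₂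
      exact h₁.unique h₂
    · intro u
      obtain ⟨t, ht, -, ⟨z, hz, rfl⟩, hu⟩ := hcone.subset u.2
      obtain ⟨z₀, hz₀, hTz₀⟩ := h0
      obtain ⟨n, hn⟩ := exists_nat_ge (max t (max ‖z‖ ‖z₀‖))
      simp only [max_le_iff] at hn
      have hn1 : (0 : ℝ) < n + 1 := by positivity
      have hmem : (t / (n + 1 : ℝ)) • z + (1 - t / (n + 1 : ℝ)) • z₀
          ∈ C ∩ Metric.closedBall 0 n := by
        refine hD n ⟨hz, by simpa using hn.2.1⟩ ⟨hz₀, by simpa using hn.2.2⟩ (by positivity)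
          ?_ (by ring)
        rw [sub_nonneg, div_le_one hn1]
        linarith
      refine ⟨n, (n + 1 : ℝ)⁻¹ • u, ⟨_, hmem, ?_⟩, ?_⟩
      · rw [map_add, map_smul, map_smul, hTz₀, smul_zero, add_zero, Submodule.coe_smul, hu,
          smul_smul, div_eq_inv_mul]
      · rw [smul_inv_smul₀ hn1.ne']
  obtain ⟨ε, hε, hball⟩ := Metric.mem_nhds_iff.1 hn
  refine ⟨n, ε, hε, fun u hu hun => ?_⟩
  obtain ⟨z, ⟨hz, hzn⟩, hzu⟩ := hball (show (⟨u, hu⟩ : S) ∈ Metric.ball 0 ε by simpa using hun)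
  exact ⟨z, hz, by simpa using hzn, hzu⟩

/-- A point interior to the domain of a convex set-valued map whose graph has nonempty interior
lies below an interior point of the graph. -/
theorem exists_mem_interior_graph {F : X → Set Y} (hF : Convex ℝ {p : X × Y | p.2 ∈ F p.1})
    (hne : (interior {p : X × Y | p.2 ∈ F p.1}).Nonempty) {x : X} (hx : x ∈ interior (sdom F)) :
    ∃ y, (x, y) ∈ interior {p : X × Y | p.2 ∈ F p.1} := by
  obtain ⟨⟨x₀, y₀⟩, h₀⟩ := hne
  have hcont : Tendsto (fun d : ℝ => x + d • (x - x₀)) (𝓝 0) (𝓝 x) := by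
    simpa using (by fun_prop : Continuous fun d : ℝ => x + d • (x - x₀)).tendsto 0
  have hev : ∀ᶠ d in 𝓝[>] (0 : ℝ), x + d • (x - x₀) ∈ sdom F :=
    nhdsWithin_le_nhds (hcont (mem_interior_iff_mem_nhds.1 hx))
  obtain ⟨d, ⟨y₁, hy₁⟩, hd⟩ := (hev.and self_mem_nhdsWithin).exists
  replace hd : 0 < d := hd
  have h := hF.combo_interior_self_subset_interior
    (a := d / (1 + d)) (b := 1 / (1 + d)) (by positivity) (by positivity) (by field_simp; ring)
    (add_mem_add (smul_mem_smul_set h₀)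
      (smul_mem_smul_set (show (x + d • (x - x₀), y₁) ∈ {p : X × Y | p.2 ∈ F p.1} from hy₁)))
  refine ⟨(d / (1 + d)) • y₀ + (1 / (1 + d)) • y₁, ?_⟩
  convert h using 1
  simp only [Prod.smul_mk, Prod.mk_add_mk, Prod.mk.injEq, and_true]
  have hd1 : (1 + d) ≠ 0 := by positivity
  match_scalars
  · field_simp
  · field_simp
    ring

theorem le_svConj {F : X → Set Y} (xs : X →L[ℝ] ℝ) (ys : Y →L[ℝ] ℝ) {x : X} {y : Y}
    (hy : y ∈ F x) : ((xs x + ys y : ℝ) : EReal) ≤ svConj F xs ys :=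
  le_sSup ⟨(x, y), hy, rfl⟩

theorem svConj_le {F : X → Set Y} {xs : X →L[ℝ] ℝ} {ys : Y →L[ℝ] ℝ} {r : ℝ}
    (h : ∀ x, ∀ y ∈ F x, xs x + ys y ≤ r) : svConj F xs ys ≤ r := by
  refine sSup_le ?_
  rintro _ ⟨⟨x, y⟩, hy, rfl⟩
  exact EReal.coe_le_coe_iff.2 (h x y hy)

theorem svConj_add_le_svConj_add (F₁ F₂ : X → Set Y) (a b : X →L[ℝ] ℝ) (ys : Y →L[ℝ] ℝ) :
    svConj (fun x => F₁ x + F₂ x) (a + b) ys ≤ svConj F₁ a ys + svConj F₂ b ys := by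
  refine sSup_le ?_
  rintro _ ⟨⟨x, -⟩, ⟨y₁, hy₁, y₂, hy₂, rfl⟩, rfl⟩
  calc (((a + b) x + ys (y₁ + y₂) : ℝ) : EReal)
      = ((a x + ys y₁ : ℝ) : EReal) + ((b x + ys y₂ : ℝ) : EReal) := by
        rw [← EReal.coe_add, _root_.add_apply, map_add]
        congr 1
        ring
    _ ≤ _ := add_le_add (le_svConj a ys hy₁) (le_svConj b ys hy₂)

theorem svConj_add_svConj_le {F₁ F₂ : X → Set Y} {a b : X →L[ℝ] ℝ} {ys : Y →L[ℝ] ℝ} {r : ℝ}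
    (h₁ : (sdom F₁).Nonempty) (h : ∀ x₁, ∀ y₁ ∈ F₁ x₁, ∀ x₂, ∀ y₂ ∈ F₂ x₂,
      (a x₁ + ys y₁) + (b x₂ + ys y₂) ≤ r) :
    svConj F₁ a ys + svConj F₂ b ys ≤ r := by
  obtain ⟨x₁, y₁, hy₁⟩ := h₁
  by_cases h₂ : ∃ x₂ y₂, y₂ ∈ F₂ x₂
  · obtain ⟨x₂, y₂, hy₂⟩ := h₂
    have hle : svConj F₁ a ys ≤ ((r - (b x₂ + ys y₂) : ℝ) : EReal) :=
      svConj_le fun x y hy => by linarith [h x y hy x₂ y₂ hy₂]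
    have hge := le_svConj a ys hy₁
    lift svConj F₁ a ys to ℝ using
      ⟨(hle.trans_lt (EReal.coe_lt_top _)).ne, ((EReal.bot_lt_coe _).trans_le hge).ne'⟩
      with α hα
    have hle₂ : svConj F₂ b ys ≤ ((r - α : ℝ) : EReal) := svConj_le fun x y hy => by
      have : svConj F₁ a ys ≤ ((r - (b x + ys y) : ℝ) : EReal) :=
        svConj_le fun x' y' hy' => by linarith [h x' y' hy' x y hy]
      rw [← hα, EReal.coe_le_coe_iff] at this
      linarith
    calc (α : EReal) + svConj F₂ b ys ≤ (α : EReal) + ((r - α : ℝ) : EReal) := by gcongr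
      _ = r := by rw [← EReal.coe_add, add_sub_cancel]
  · have : svConj F₂ b ys = ⊥ := by
      refine sSup_eq_bot.2 ?_
      rintro _ ⟨⟨x, y⟩, hy, rfl⟩
      exact absurd ⟨x, y, hy⟩ h₂
    simp [this]

/-- Sufficiency of a boundedness condition on the value function near zero for an exact
decomposition of the conjugate of a sum. -/
theorem exists_split_of_bounded_near_zero {F₁ F₂ : X → Set Y}
    (h₁ : Convex ℝ {p : X × Y | p.2 ∈ F₁ p.1}) (h₂ : Convex ℝ {p : X × Y | p.2 ∈ F₂ p.1})
    (S : Submodule ℝ X) (hS : sdom F₁ - sdom F₂ ⊆ S) {xs : X →L[ℝ] ℝ} {ys : Y →L[ℝ] ℝ}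
    {r ε c : ℝ} (hr : ∀ x, ∀ y₁ ∈ F₁ x, ∀ y₂ ∈ F₂ x, xs x + ys (y₁ + y₂) ≤ r) (hε : 0 < ε)
    (hb : ∀ u ∈ S, ‖u‖ < ε → ∃ x₁, ∃ y₁ ∈ F₁ x₁, ∃ x₂, ∃ y₂ ∈ F₂ x₂,
      x₁ - x₂ = u ∧ c ≤ xs x₁ + ys y₁ + ys y₂) :
    ∃ a b : X →L[ℝ] ℝ, a + b = xs ∧ ∀ x₁, ∀ y₁ ∈ F₁ x₁, ∀ x₂, ∀ y₂ ∈ F₂ x₂,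
      (a x₁ + ys y₁) + (b x₂ + ys y₂) ≤ r := by
  obtain ⟨φ, hφ⟩ := exists_multiplier_of_bounded_near_zero S (h₁.prod h₂)
    (LinearMap.fst ℝ X Y ∘ₗ LinearMap.fst ℝ (X × Y) (X × Y)
      - LinearMap.fst ℝ X Y ∘ₗ LinearMap.snd ℝ (X × Y) (X × Y))
    ((xs : X →ₗ[ℝ] ℝ) ∘ₗ LinearMap.fst ℝ X Y ∘ₗ LinearMap.fst ℝ (X × Y) (X × Y)
      + (ys : Y →ₗ[ℝ] ℝ) ∘ₗ LinearMap.snd ℝ X Y ∘ₗ LinearMap.fst ℝ (X × Y) (X × Y)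
      + (ys : Y →ₗ[ℝ] ℝ) ∘ₗ LinearMap.snd ℝ X Y ∘ₗ LinearMap.snd ℝ (X × Y) (X × Y))
    (r := r) (ε := ε) (c := c)
    (by
      rintro ⟨⟨x₁, y₁⟩, ⟨x₂, y₂⟩⟩ ⟨hy₁, hy₂⟩
      exact hS (sub_mem_sub ⟨y₁, hy₁⟩ ⟨y₂, hy₂⟩))
    (by
      rintro ⟨⟨x₁, y₁⟩, ⟨x₂, y₂⟩⟩ ⟨hy₁, hy₂⟩ hx
      obtain rfl : x₁ = x₂ := sub_eq_zero.1 hx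
      have h := hr x₁ y₁ hy₁ y₂ hy₂
      rw [map_add, ← add_assoc] at h
      exact h)
    hε
    (by
      intro u hu hun
      obtain ⟨x₁, y₁, hy₁, x₂, y₂, hy₂, hx, hc⟩ := hb u hu hun
      exact ⟨((x₁, y₁), (x₂, y₂)), ⟨hy₁, hy₂⟩, hx, hc⟩)
  refine ⟨xs - φ, φ, sub_add_cancel _ _, fun x₁ y₁ hy₁ x₂ y₂ hy₂ => ?_⟩
  have h := hφ ((x₁, y₁), (x₂, y₂)) ⟨hy₁, hy₂⟩
  simp only [LinearMap.add_apply, LinearMap.sub_apply, LinearMap.comp_apply, LinearMap.fst_apply,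
    LinearMap.snd_apply, ContinuousLinearMap.coe_coe, map_sub] at h
  rw [_root_.sub_apply]
  linarith

theorem exists_split_of_interior {F₁ F₂ : X → Set Y}
    (h₁ : Convex ℝ {p : X × Y | p.2 ∈ F₁ p.1}) (h₂ : Convex ℝ {p : X × Y | p.2 ∈ F₂ p.1})
    (hne : (interior {p : X × Y | p.2 ∈ F₁ p.1}).Nonempty)
    (hdom : (interior (sdom F₁) ∩ sdom F₂).Nonempty) {xs : X →L[ℝ] ℝ} {ys : Y →L[ℝ] ℝ}
    {r : ℝ} (hr : ∀ x, ∀ y₁ ∈ F₁ x, ∀ y₂ ∈ F₂ x, xs x + ys (y₁ + y₂) ≤ r) :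
    ∃ a b : X →L[ℝ] ℝ, a + b = xs ∧ ∀ x₁, ∀ y₁ ∈ F₁ x₁, ∀ x₂, ∀ y₂ ∈ F₂ x₂,
      (a x₁ + ys y₁) + (b x₂ + ys y₂) ≤ r := by
  obtain ⟨x, hx, y₂, hy₂⟩ := hdom
  obtain ⟨y₁, hy₁⟩ := exists_mem_interior_graph h₁ hne hx
  have hgraph : ∀ᶠ u in 𝓝 (0 : X), y₁ ∈ F₁ (x + u) := by
    have hcont : Tendsto (fun u : X => (x + u, y₁)) (𝓝 0) (𝓝 (x, y₁)) := by
      simpa using (by fun_prop : Continuous fun u : X => (x + u, y₁)).tendsto 0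
    exact hcont (mem_interior_iff_mem_nhds.1 hy₁)
  have hval : ∀ᶠ u in 𝓝 (0 : X), xs x - 1 < xs (x + u) := by
    have hcont : Tendsto (fun u : X => xs (x + u)) (𝓝 0) (𝓝 (xs x)) := by
      simpa using (by fun_prop : Continuous fun u : X => xs (x + u)).tendsto 0
    exact hcont (lt_mem_nhds (sub_one_lt _))
  obtain ⟨ε, hε, hball⟩ := Metric.eventually_nhds_iff.1 (hgraph.and hval)
  refine exists_split_of_bounded_near_zero h₁ h₂ ⊤ (fun _ _ => trivial) hr hε
    (c := xs x - 1 + ys y₁ + ys y₂) fun u _ hu => ?_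
  obtain ⟨hy, hlt⟩ := hball (y := u) (by simpa using hu)
  exact ⟨x + u, y₁, hy, x, y₂, hy₂, add_sub_cancel_left x u, by linarith⟩

theorem exists_split_of_zeroSqri [CompleteSpace X] [CompleteSpace Y] {F₁ F₂ : X → Set Y}
    (hc₁ : IsClosed {p : X × Y | p.2 ∈ F₁ p.1}) (h₁ : Convex ℝ {p : X × Y | p.2 ∈ F₁ p.1})
    (hc₂ : IsClosed {p : X × Y | p.2 ∈ F₂ p.1}) (h₂ : Convex ℝ {p : X × Y | p.2 ∈ F₂ p.1})
    (hq : ZeroSqri (sdom F₁ - sdom F₂)) {xs : X →L[ℝ] ℝ} {ys : Y →L[ℝ] ℝ}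
    {r : ℝ} (hr : ∀ x, ∀ y₁ ∈ F₁ x, ∀ y₂ ∈ F₂ x, xs x + ys (y₁ + y₂) ≤ r) :
    ∃ a b : X →L[ℝ] ℝ, a + b = xs ∧ ∀ x₁, ∀ y₁ ∈ F₁ x₁, ∀ x₂, ∀ y₂ ∈ F₂ x₂,
      (a x₁ + ys y₁) + (b x₂ + ys y₂) ≤ r := by
  obtain ⟨h0, S, hcone, hS⟩ := hq
  let T : (X × Y) × (X × Y) →L[ℝ] X :=
    .comp (.fst ℝ X Y) (.fst ℝ (X × Y) (X × Y)) - .comp (.fst ℝ X Y) (.snd ℝ (X × Y) (X × Y))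
  let h : (X × Y) × (X × Y) →L[ℝ] ℝ :=
    xs.comp (.comp (.fst ℝ X Y) (.fst ℝ (X × Y) (X × Y)))
      + ys.comp (.comp (.snd ℝ X Y) (.fst ℝ (X × Y) (X × Y)))
      + ys.comp (.comp (.snd ℝ X Y) (.snd ℝ (X × Y) (X × Y)))
  have himage : sdom F₁ - sdom F₂
      = T '' ({p : X × Y | p.2 ∈ F₁ p.1} ×ˢ {p : X × Y | p.2 ∈ F₂ p.1}) := by
    ext u
    constructor
    · rintro ⟨x₁, ⟨y₁, hy₁⟩, x₂, ⟨y₂, hy₂⟩, rfl⟩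
      exact ⟨((x₁, y₁), (x₂, y₂)), ⟨hy₁, hy₂⟩, rfl⟩
    · rintro ⟨⟨⟨x₁, y₁⟩, ⟨x₂, y₂⟩⟩, ⟨hy₁, hy₂⟩, rfl⟩
      exact sub_mem_sub ⟨y₁, hy₁⟩ ⟨y₂, hy₂⟩
  have hsub : sdom F₁ - sdom F₂ ⊆ S := by
    rw [hcone]
    exact fun u hu => ⟨1, zero_le_one, u, hu, (one_smul ℝ u).symm⟩
  rw [himage] at h0 hcone
  obtain ⟨n, ε, hε, hpre⟩ := exists_bounded_preimage hS (h₁.prod h₂) (hc₁.prod hc₂) T h0 hcone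
  refine exists_split_of_bounded_near_zero h₁ h₂ S hsub hr hε (c := -(‖h‖ * n)) fun u hu hun => ?_
  obtain ⟨⟨⟨x₁, y₁⟩, ⟨x₂, y₂⟩⟩, ⟨hy₁, hy₂⟩, hz, hTz⟩ := hpre u hu hun
  refine ⟨x₁, y₁, hy₁, x₂, y₂, hy₂, hTz, ?_⟩
  have hbound := (abs_le.1 ((h.le_opNorm ((x₁, y₁), (x₂, y₂))).trans
    (mul_le_mul_of_nonneg_left hz (norm_nonneg h)))).1
  exact hbound

theorem exists_split_of_isPolyMap {F₁ F₂ : X → Set Y} (h₁ : IsPolyMap F₁) (h₂ : IsPolyMap F₂)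
    (hdom : (sdom F₁ ∩ sdom F₂).Nonempty) {xs : X →L[ℝ] ℝ} {ys : Y →L[ℝ] ℝ}
    {r : ℝ} (hr : ∀ x, ∀ y₁ ∈ F₁ x, ∀ y₂ ∈ F₂ x, xs x + ys (y₁ + y₂) ≤ r) :
    ∃ a b : X →L[ℝ] ℝ, a + b = xs ∧ ∀ x₁, ∀ y₁ ∈ F₁ x₁, ∀ x₂, ∀ y₂ ∈ F₂ x₂,
      (a x₁ + ys y₁) + (b x₂ + ys y₂) ≤ r := by
  obtain ⟨m₁, a₁, c₁, b₁, hG₁⟩ := h₁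
  obtain ⟨m₂, a₂, c₂, b₂, hG₂⟩ := h₂
  have hF₁ : ∀ x y, y ∈ F₁ x ↔ ∀ i, a₁ i x + c₁ i y ≤ b₁ i := fun x y =>
    Set.ext_iff.1 hG₁ (x, y)
  have hF₂ : ∀ x y, y ∈ F₂ x ↔ ∀ i, a₂ i x + c₂ i y ≤ b₂ i := fun x y =>
    Set.ext_iff.1 hG₂ (x, y)
  let f : Fin (m₁ + m₂) → X × (Y × Y) →ₗ[ℝ] ℝ := Fin.append
    (fun i => ((a₁ i).coprod ((c₁ i).coprod (0 : Y →L[ℝ] ℝ))).toLinearMap)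
    (fun j => ((a₂ j).coprod ((0 : Y →L[ℝ] ℝ).coprod (c₂ j))).toLinearMap)
  have hf : ∀ x y₁ y₂, (∀ k, f k (x, y₁, y₂) ≤ Fin.append b₁ b₂ k) ↔ y₁ ∈ F₁ x ∧ y₂ ∈ F₂ x := by
    intro x y₁ y₂
    rw [hF₁, hF₂]
    constructor
    · exact fun h => ⟨fun i => by simpa [f] using h (Fin.castAdd m₂ i),
        fun j => by simpa [f] using h (Fin.natAdd m₁ j)⟩
    · rintro ⟨h, h'⟩ k
      refine Fin.addCases (fun i => ?_) (fun j => ?_) k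
      · simpa [f] using h i
      · simpa [f] using h' j
  obtain ⟨x, ⟨y₁, hy₁⟩, ⟨y₂, hy₂⟩⟩ := hdom
  obtain ⟨l, hl, hlg, hlb⟩ := exists_nonneg_sum_eq_of_le f (Fin.append b₁ b₂)
    (xs.coprod (ys.coprod ys)).toLinearMap r ⟨(x, y₁, y₂), (hf x y₁ y₂).2 ⟨hy₁, hy₂⟩⟩ (by
      rintro ⟨x, y₁, y₂⟩ h
      rw [hf] at h
      simpa using hr x y₁ h.1 y₂ h.2)
  simp only [Fin.sum_univ_add, f, Fin.append_left, Fin.append_right] at hlg hlb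
  have hx : ∀ x, xs x = ∑ i, l (Fin.castAdd m₂ i) * a₁ i x + ∑ j, l (Fin.natAdd m₁ j) * a₂ j x :=
    fun x => by simpa using hlg (x, 0, 0)
  have hy : ∀ y, ys y = ∑ i, l (Fin.castAdd m₂ i) * c₁ i y :=
    fun y => by simpa using hlg (0, y, 0)
  have hy' : ∀ y, ys y = ∑ j, l (Fin.natAdd m₁ j) * c₂ j y :=
    fun y => by simpa using hlg (0, 0, y)
  refine ⟨∑ i, l (Fin.castAdd m₂ i) • a₁ i, ∑ j, l (Fin.natAdd m₁ j) • a₂ j, ?_,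
    fun x₁ y₁ hy₁ x₂ y₂ hy₂ => ?_⟩
  · ext x
    simp [hx x]
  · refine le_trans ?_ hlb
    rw [hy y₁, hy' y₂]
    simp only [_root_.sum_apply, _root_.smul_apply, smul_eq_mul,
      ← Finset.sum_add_distrib, ← mul_add]
    exact add_le_add
      (Finset.sum_le_sum fun i _ => mul_le_mul_of_nonneg_left ((hF₁ _ _).1 hy₁ i) (hl _))
      (Finset.sum_le_sum fun j _ => mul_le_mul_of_nonneg_left ((hF₂ _ _).1 hy₂ j) (hl _))

/-- Fenchel conjugate sum rule for set-valued mappings in infinite dimensions. -/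
theorem svConj_sum_rule (F1 F2 : X → Set Y) (xs : X →L[ℝ] ℝ) (ys : Y →L[ℝ] ℝ) :
    svConj (fun x => F1 x + F2 x) xs ys ≤
      sInf {z : EReal | ∃ a b : X →L[ℝ] ℝ, a + b = xs ∧
        z = svConj F1 a ys + svConj F2 b ys} ∧
    ((Convex ℝ {p : X × Y | p.2 ∈ F1 p.1} ∧ Convex ℝ {p : X × Y | p.2 ∈ F2 p.1} ∧
        (interior {p : X × Y | p.2 ∈ F1 p.1}).Nonempty ∧
        (interior (sdom F1) ∩ sdom F2).Nonempty) ∨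
      (IsPolyMap F1 ∧ IsPolyMap F2 ∧ (sdom F1 ∩ sdom F2).Nonempty) ∨
      (CompleteSpace X ∧ CompleteSpace Y ∧
        IsClosed {p : X × Y | p.2 ∈ F1 p.1} ∧ Convex ℝ {p : X × Y | p.2 ∈ F1 p.1} ∧
        IsClosed {p : X × Y | p.2 ∈ F2 p.1} ∧ Convex ℝ {p : X × Y | p.2 ∈ F2 p.1} ∧
        ZeroSqri (sdom F1 - sdom F2)) →
      svConj (fun x => F1 x + F2 x) xs ys =
        sInf {z : EReal | ∃ a b : X →L[ℝ] ℝ, a + b = xs ∧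
          z = svConj F1 a ys + svConj F2 b ys} ∧
      (∀ r : ℝ, svConj (fun x => F1 x + F2 x) xs ys = (r : EReal) →
        ∃ a b : X →L[ℝ] ℝ, a + b = xs ∧
          svConj (fun x => F1 x + F2 x) xs ys = svConj F1 a ys + svConj F2 b ys)) := by
  have hle : svConj (fun x => F1 x + F2 x) xs ys ≤
      sInf {z : EReal | ∃ a b : X →L[ℝ] ℝ, a + b = xs ∧
        z = svConj F1 a ys + svConj F2 b ys} := by
    refine le_sInf ?_
    rintro _ ⟨a, b, rfl, rfl⟩
    exact svConj_add_le_svConj_add F1 F2 a b ys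
  refine ⟨hle, fun hcond => ?_⟩
  have hdom : (sdom F1 ∩ sdom F2).Nonempty := by
    rcases hcond with h | h | h
    · exact h.2.2.2.mono (inter_subset_inter_left _ interior_subset)
    · exact h.2.2
    · obtain ⟨x₁, hx₁, x₂, hx₂, hx⟩ := h.2.2.2.2.2.2.1
      obtain rfl : x₁ = x₂ := sub_eq_zero.1 hx
      exact ⟨x₁, hx₁, hx₂⟩
  have hatt : ∀ r : ℝ, svConj (fun x => F1 x + F2 x) xs ys = (r : EReal) →
      ∃ a b : X →L[ℝ] ℝ, a + b = xs ∧
        svConj (fun x => F1 x + F2 x) xs ys = svConj F1 a ys + svConj F2 b ys := by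
    intro r hr
    have hbound : ∀ x, ∀ y₁ ∈ F1 x, ∀ y₂ ∈ F2 x, xs x + ys (y₁ + y₂) ≤ r := by
      intro x y₁ hy₁ y₂ hy₂
      have h := le_svConj (F := fun x => F1 x + F2 x) xs ys (add_mem_add hy₁ hy₂)
      rwa [hr, EReal.coe_le_coe_iff] at h
    obtain ⟨a, b, hab, h⟩ : ∃ a b : X →L[ℝ] ℝ, a + b = xs ∧ ∀ x₁, ∀ y₁ ∈ F1 x₁, ∀ x₂,
        ∀ y₂ ∈ F2 x₂, (a x₁ + ys y₁) + (b x₂ + ys y₂) ≤ r := by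
      rcases hcond with ⟨h₁, h₂, hne, hd⟩ | ⟨h₁, h₂, hd⟩ | ⟨_, _, hc₁, h₁, hc₂, h₂, hq⟩
      · exact exists_split_of_interior h₁ h₂ hne hd hbound
      · exact exists_split_of_isPolyMap h₁ h₂ hd hbound
      · exact exists_split_of_zeroSqri hc₁ h₁ hc₂ h₂ hq hbound
    refine ⟨a, b, hab, le_antisymm ?_ ?_⟩
    · rw [← hab]
      exact svConj_add_le_svConj_add F1 F2 a b ys
    · rw [hr]
      exact svConj_add_svConj_le (hdom.mono inter_subset_left) h
  refine ⟨le_antisymm hle ?_, hatt⟩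
  induction hv : svConj (fun x => F1 x + F2 x) xs ys with
  | bot =>
    obtain ⟨x, ⟨y₁, hy₁⟩, ⟨y₂, hy₂⟩⟩ := hdom
    have h := le_svConj (F := fun x => F1 x + F2 x) xs ys (add_mem_add hy₁ hy₂)
    rw [hv] at h
    exact absurd (le_bot_iff.1 h) (EReal.coe_ne_bot _)
  | top => exact le_top
  | coe r =>
    obtain ⟨a, b, hab, h⟩ := hatt r hv
    exact sInf_le ⟨a, b, hab, hv.symm.trans h⟩

end
end

section
/- Let F₁, F₂: X ⇉ Y be convex set-valued mappings. Suppose one of the following qualification conditions holds: (i) X = ℝⁿ, Y = ℝᵖ and ri(dom F₁) ∩ ri(dom F₂) ≠ ∅; (ii) X, Y are real locally convex Hausdorff topological vector spaces, int(gph F₁) ≠ ∅, and int(dom F₁) ∩ dom F₂ ≠ ∅; (iii) X, Y are Banach spaces, F₁ and F₂ have closed convex graphs, and 0 ∈ sqri(dom F₁ − dom F₂). Then for every (x̄, ȳ) ∈ gph(F₁+F₂) and every pair (ȳ₁, ȳ₂) with ȳ₁ ∈ F₁(x̄), ȳ₂ ∈ F₂(x̄), and ȳ = ȳ₁ + ȳ₂,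 one has, for every y* ∈ Y*, D*(F₁+F₂)(x̄, ȳ)(y*) = D*F₁(x̄, ȳ₁)(y*) + D*F₂(x̄, ȳ₂)(y*). -/
open Pointwise

noncomputable section

variable {X Y : Type*} [NormedAddCommGroup X] [NormedSpace ℝ X]
  [NormedAddCommGroup Y] [NormedSpace ℝ Y]

/-- Coderivative of `F` at `(xb, yb) ∈ gph F`:
`x* ∈ D*F(xb, yb)(y*)` iff `(x*, -y*)` is in the normal cone to `gph F` at `(xb, yb)`. -/
def coderiv (F : X → Set Y) (xb : X) (yb : Y) (ys : Y →L[ℝ] ℝ) : Set (X →L[ℝ] ℝ) :=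
  {xs | ∀ p : X × Y, p.2 ∈ F p.1 → xs (p.1 - xb) - ys (p.2 - yb) ≤ 0}

/-- A convex set `A ⊆ V × ℝ` through the origin, meeting the vertical axis only in nonnegative
heights and with absorbing projection to `V`, lies above the graph of a linear functional. -/
theorem exists_linearMap_le_of_convex {V : Type*} [AddCommGroup V] [Module ℝ V]
    {A : Set (V × ℝ)} (hA : Convex ℝ A) (h0 : (0, 0) ∈ A) (hpos : ∀ s, (0, s) ∈ A → 0 ≤ s)
    (habs : ∀ v, ∃ t : ℝ, 0 < t ∧ ∃ s, (t • v, s) ∈ A) :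
    ∃ f : V →ₗ[ℝ] ℝ, ∀ v s, (v, s) ∈ A → f v ≤ s := by
  have hmem : ∀ x, x ∈ ConvexCone.hull ℝ A ↔ ∃ c : ℝ, 0 < c ∧ ∃ y ∈ A, c • y = x := fun x =>
    ConvexCone.mem_hull_of_convex hA
  have hpt : (ConvexCone.hull ℝ A).Pointed := ConvexCone.subset_hull h0
  obtain ⟨g, hg, hgA⟩ := riesz_extension ((ConvexCone.hull ℝ A).toPointedCone hpt)
    ⟨LinearMap.range (LinearMap.inr ℝ V ℝ), (LinearMap.snd ℝ V ℝ).comp (Submodule.subtype _)⟩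
    (by
      rintro ⟨_, r, rfl⟩ hx
      obtain ⟨c, hc, ⟨v, s⟩, hy, hxy⟩ := (hmem _).1 hx
      obtain ⟨hv, hs⟩ : c • v = 0 ∧ c * s = r := by simpa using hxy
      obtain rfl : v = 0 := (smul_eq_zero.1 hv).resolve_left hc.ne'
      have : 0 ≤ r := hs ▸ mul_nonneg hc.le (hpos s hy)
      simpa using this)
    (by
      rintro ⟨v, r⟩
      obtain ⟨t, ht, s, hs⟩ := habs v
      refine ⟨⟨(0, t⁻¹ * s - r), t⁻¹ * s - r, rfl⟩, (hmem _).2 ⟨t⁻¹, inv_pos.2 ht, _, hs, ?_⟩⟩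
      simp [smul_smul, inv_mul_cancel₀ ht.ne'])
  refine ⟨-(g.comp (LinearMap.inl ℝ V ℝ)), fun v s hvs => ?_⟩
  have h1 : g (0, s) = s := hg ⟨(0, s), s, rfl⟩
  have h2 : 0 ≤ g (v, s) := hgA _ (ConvexCone.subset_hull hvs)
  have h3 : g (v, s) = g (v, 0) + g (0, s) := by rw [← map_add]; simp
  simp only [LinearMap.neg_apply, LinearMap.comp_apply, LinearMap.inl_apply]
  linarith

/-- A linear functional that is bounded above on a ball around the origin is continuous. -/
theorem LinearMap.continuous_of_le_on_ball {E : Type*} [NormedAddCommGroup E] [NormedSpace ℝ E]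
    (f : E →ₗ[ℝ] ℝ) {r M : ℝ} (hr : 0 < r) (h : ∀ u, ‖u‖ < r → f u ≤ M) : Continuous f := by
  obtain ⟨C, hC⟩ := f.bound_of_ball_bound hr M fun u hu => by
    rw [mem_ball_zero_iff] at hu
    have h' := h (-u) (by rwa [norm_neg])
    rw [map_neg] at h'
    exact abs_le.2 ⟨by linarith, h u hu⟩
  exact (f.mkContinuous C hC).continuous

/-- A convex set `A ⊆ X × ℝ` through the origin lies above the graph of a continuous linear
functional, provided it meets the vertical axis only in nonnegative heights and its projection is
absorbing in a subspace `S` which is either finite-dimensional or on which `A` is bounded above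
near the origin. -/
theorem exists_continuousLinearMap_le_of_convex {A : Set (X × ℝ)} (hA : Convex ℝ A)
    (h0 : (0, 0) ∈ A) (hpos : ∀ s, (0, s) ∈ A → 0 ≤ s) (S : Submodule ℝ X)
    (hAS : ∀ p ∈ A, p.1 ∈ S) (habs : ∀ u ∈ S, ∃ t : ℝ, 0 < t ∧ ∃ s, (t • u, s) ∈ A)
    (hS : FiniteDimensional ℝ S ∨
      ∃ r > 0, ∃ M : ℝ, ∀ u ∈ S, ‖u‖ < r → ∃ s ≤ M, (u, s) ∈ A) :
    ∃ g : X →L[ℝ] ℝ, ∀ p ∈ A, g p.1 ≤ p.2 := by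
  obtain ⟨f, hf⟩ := exists_linearMap_le_of_convex (V := S)
    (A := S.subtype.prodMap LinearMap.id ⁻¹' A) (hA.linear_preimage _) (by simpa using h0)
    (fun s hs => hpos s (by simpa using hs)) (fun v => by
      obtain ⟨t, ht, s, hs⟩ := habs v v.2
      exact ⟨t, ht, s, by simpa using hs⟩)
  have hcont : Continuous f := by
    rcases hS with hS | ⟨r, hr, M, h⟩
    · exact f.continuous_of_finiteDimensional
    · refine f.continuous_of_le_on_ball hr (M := M) fun u hu => ?_
      obtain ⟨s, hs, hus⟩ := h u u.2 hu
      exact (hf u s (by simpa using hus)).trans hs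
  obtain ⟨g, hg, -⟩ := exists_extension_norm_eq S ⟨f, hcont⟩
  refine ⟨g, fun p hp => ?_⟩
  have := hf ⟨p.1, hAS p hp⟩ p.2 hp
  rw [← ContinuousLinearMap.coe_mk' f hcont, ← hg] at this
  exact this

theorem Convex.sum_geometric_smul_mem {Z : Type*} [AddCommGroup Z] [Module ℝ Z] {C : Set Z}
    (hC : Convex ℝ C) (h0 : (0 : Z) ∈ C) (n : ℕ) (c : ℕ → Z) (hc : ∀ k, c k ∈ C) :
    ∑ k ∈ Finset.range n, (1 / 2 : ℝ) ^ (k + 1) • c k ∈ C := by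
  induction n generalizing c with
  | zero => simpa using h0
  | succ n ih =>
    have := hC (ih (fun k => c (k + 1)) fun k => hc (k + 1)) (hc 0)
      (a := 1 / 2) (b := 1 / 2) (by norm_num) (by norm_num) (by norm_num)
    rw [Finset.sum_range_succ']
    rw [Finset.smul_sum] at this
    simpa only [smul_smul, ← pow_succ', zero_add, pow_one] using this

/-- Open mapping principle for a bounded closed convex set: if the cone generated by the image of
`C` is a Banach space, then this image is a neighbourhood of the origin. -/
theorem Convex.exists_ball_subset_image {Z W : Type*} [NormedAddCommGroup Z] [NormedSpace ℝ Z]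
    [CompleteSpace Z] [NormedAddCommGroup W] [NormedSpace ℝ W] (T : Z →L[ℝ] W)
    (S : Submodule ℝ W) [CompleteSpace S] {C : Set Z} (hC : Convex ℝ C) (hcl : IsClosed C)
    (h0 : (0 : Z) ∈ C) {R : ℝ} (hR : ∀ z ∈ C, ‖z‖ ≤ R) (hTS : ∀ z ∈ C, T z ∈ S)
    (hcone : ∀ u ∈ S, ∃ n : ℕ, ∃ z ∈ C, u = ((n : ℝ) + 1) • T z) :
    ∃ r > 0, ∀ u ∈ S, ‖u‖ < r → ∃ z ∈ C, T z = u := by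
  let P : Set S := S.subtype ⁻¹' (T '' C)
  have hP : Convex ℝ P := (hC.linear_image T.toLinearMap).linear_preimage _
  have hcover : ∀ u : S, ∃ n : ℕ, ∃ q ∈ closure P, u = ((n : ℝ) + 1) • q := fun u => by
    obtain ⟨n, z, hz, hu⟩ := hcone u u.2
    exact ⟨n, ⟨T z, hTS z hz⟩, subset_closure ⟨z, hz, rfl⟩, Subtype.ext hu⟩
  have hne : ∀ n : ℕ, (n : ℝ) + 1 ≠ 0 := fun n => by positivity
  obtain ⟨n, hn⟩ := nonempty_interior_of_iUnion_of_closed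
    (f := fun n : ℕ => ((n : ℝ) + 1) • closure P)
    (fun n => isClosed_closure.smul_of_ne_zero (hne n)) (by
      refine Set.eq_univ_of_forall fun u => Set.mem_iUnion.2 ?_
      obtain ⟨n, q, hq, hu⟩ := hcover u
      exact ⟨n, q, hq, hu.symm⟩)
  rw [interior_smul₀ (hne n)] at hn
  obtain ⟨_, v, hv, -⟩ := hn
  obtain ⟨m, q, hq, hvq⟩ := hcover (-v)
  have hint : (0 : S) ∈ interior (closure P) := by
    have hm : (0 : ℝ) < (m : ℝ) + 2 := by positivity
    have := hP.closure.combo_interior_self_mem_interior hv hq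
      (a := 1 / ((m : ℝ) + 2)) (b := ((m : ℝ) + 1) / ((m : ℝ) + 2)) (by positivity)
      (by positivity) (by field_simp; ring)
    convert this using 1
    have hv' : v = -(((m : ℝ) + 1) • q) := by rw [← hvq, neg_neg]
    rw [hv', div_eq_mul_inv, div_eq_mul_inv, mul_comm ((m : ℝ) + 1), mul_smul, mul_smul]
    simp
  obtain ⟨r, hr, hball⟩ := Metric.mem_nhds_iff.1 (mem_interior_iff_mem_nhds.1 hint)
  have hstep : ∀ w : S, ‖w‖ < r → ∃ z ∈ C, ∃ w' : S, ‖w'‖ < r ∧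
      (w' : W) = (2 : ℝ) • ((w : W) - T z) := fun w hw => by
    obtain ⟨p, ⟨z, hz, hpz⟩, hd⟩ := Metric.mem_closure_iff.1
      (hball (mem_ball_zero_iff.2 hw)) (r / 2) (half_pos hr)
    refine ⟨z, hz, (2 : ℝ) • (w - p), ?_, ?_⟩
    · rw [norm_smul, ← dist_eq_norm]
      norm_num
      linarith
    · simp [hpz]
  choose! z hz next hnext hnext_eq using hstep
  refine ⟨r / 2, half_pos hr, fun u hu hur => ?_⟩
  let w : ℕ → S := fun k => next^[k] ⟨(2 : ℝ) • u, S.smul_mem _ hu⟩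
  have hw : ∀ k, ‖w k‖ < r := fun k => by
    induction k with
    | zero =>
      change ‖(2 : ℝ) • u‖ < r
      rw [norm_smul]
      norm_num
      linarith
    | succ k ih =>
      simp only [w, Function.iterate_succ_apply']
      exact hnext _ ih
  have hwsucc : ∀ k, (w (k + 1) : W) = (2 : ℝ) • ((w k : W) - T (z (w k))) := fun k => by
    simp only [w, Function.iterate_succ_apply']
    exact hnext_eq _ (hw k)
  have hzC : ∀ k, z (w k) ∈ C := fun k => hz _ (hw k)
  have hsum : Summable fun k => (1 / 2 : ℝ) ^ (k + 1) • z (w k) := by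
    refine Summable.of_norm_bounded (g := fun k : ℕ => (1 / 2 : ℝ) ^ k * (1 / 2 * R))
      (summable_geometric_two.mul_right _) fun k => ?_
    rw [norm_smul, ← mul_assoc, ← pow_succ, Real.norm_of_nonneg (by positivity)]
    exact mul_le_mul_of_nonneg_left (hR _ (hzC k)) (by positivity)
  have hlim := hsum.hasSum.tendsto_sum_nat
  refine ⟨_, hcl.mem_of_tendsto hlim (Filter.Eventually.of_forall fun n =>
    hC.sum_geometric_smul_mem h0 n _ hzC), ?_⟩
  have hT : ∀ n, T (∑ k ∈ Finset.range n, (1 / 2 : ℝ) ^ (k + 1) • z (w k)) =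
      u - (1 / 2 : ℝ) ^ (n + 1) • (w n : W) := fun n => by
    induction n with
    | zero => simp [w, smul_smul]
    | succ n ih =>
      rw [Finset.sum_range_succ, map_add, ih, hwsucc, map_smul, smul_smul, pow_succ _ (n + 1),
        mul_assoc, smul_sub]
      norm_num
      abel
  have hzero : Filter.Tendsto (fun n => (1 / 2 : ℝ) ^ (n + 1) • (w n : W)) Filter.atTop
      (nhds 0) := by
    refine squeeze_zero_norm (a := fun n : ℕ => (1 / 2 : ℝ) ^ (n + 1) * r) (fun n => ?_) ?_
    · rw [norm_smul, norm_pow]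
      norm_num
      exact (hw n).le
    · have := (tendsto_pow_atTop_nhds_zero_of_lt_one (r := (1 / 2 : ℝ)) (by norm_num)
        (by norm_num)).comp (Filter.tendsto_add_atTop_nat 1)
      simpa using this.mul_const r
  refine tendsto_nhds_unique ((T.continuous.tendsto _).comp hlim) ?_
  simpa only [Function.comp_def, hT, sub_zero] using tendsto_const_nhds.sub hzero

theorem eventually_add_smul_mem_of_mem_intrinsicInterior {D : Set X} {x a : X}
    (hx : x ∈ intrinsicInterior ℝ D) (ha : a ∈ (affineSpan ℝ D).direction) :
    ∀ᶠ t : ℝ in nhds 0, x + t • a ∈ D := by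
  obtain ⟨y, hy, rfl⟩ := mem_intrinsicInterior.1 hx
  let φ : ℝ → affineSpan ℝ D := fun t =>
    ⟨t • a +ᵥ (y : X), AffineSubspace.vadd_mem_of_mem_direction (Submodule.smul_mem _ t ha) y.2⟩
  have hφ : Continuous φ := by
    refine Continuous.subtype_mk ?_ _
    simp only [vadd_eq_add]
    fun_prop
  have h0 : φ 0 = y := Subtype.ext (by simp [φ])
  have hev := hφ.continuousAt.preimage_mem_nhds (x := 0)
    (by rw [h0]; exact mem_interior_iff_mem_nhds.1 hy)
  filter_upwards [hev] with t ht
  simpa [φ, add_comm] using ht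

/-- The difference of the domains of `F1` and `F2` is absorbing in a subspace that contains it,
and this subspace is either finite-dimensional or has a neighbourhood of the origin consisting of
differences of domain points that lift to bounded parts of the two graphs. -/
def HasRegularDomDiff (F1 F2 : X → Set Y) : Prop :=
  ∃ S : Submodule ℝ X, (∀ x ∈ sdom F1, ∀ x' ∈ sdom F2, x - x' ∈ S) ∧
    (∀ u ∈ S, ∃ t : ℝ, 0 < t ∧ t • u ∈ sdom F1 - sdom F2) ∧
    (FiniteDimensional ℝ S ∨ ∃ r > 0, ∃ M : ℝ, ∀ u ∈ S, ‖u‖ < r → ∃ p q : X × Y,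
      p.2 ∈ F1 p.1 ∧ q.2 ∈ F2 q.1 ∧ p.1 - q.1 = u ∧ ‖p‖ ≤ M ∧ ‖q‖ ≤ M)

theorem hasRegularDomDiff_of_intrinsicInterior {X Y : Type*} [NormedAddCommGroup X]
    [NormedSpace ℝ X] [FiniteDimensional ℝ X] [NormedAddCommGroup Y] {F1 F2 : X → Set Y}
    (h : (intrinsicInterior ℝ (sdom F1) ∩ intrinsicInterior ℝ (sdom F2)).Nonempty) :
    HasRegularDomDiff F1 F2 := by
  obtain ⟨x0, hx1, hx2⟩ := h
  have hm1 := intrinsicInterior_subset hx1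
  have hm2 := intrinsicInterior_subset hx2
  refine ⟨(affineSpan ℝ (sdom F1)).direction ⊔ (affineSpan ℝ (sdom F2)).direction,
    fun x hx x' hx' => ?_, fun u hu => ?_, Or.inl inferInstance⟩
  · rw [← sub_sub_sub_cancel_right x x' x0]
    exact Submodule.sub_mem_sup
      (AffineSubspace.vsub_mem_direction (subset_affineSpan ℝ _ hx) (subset_affineSpan ℝ _ hm1))
      (AffineSubspace.vsub_mem_direction (subset_affineSpan ℝ _ hx') (subset_affineSpan ℝ _ hm2))
  · obtain ⟨a, ha, b, hb, rfl⟩ := Submodule.mem_sup.1 hu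
    have hev := (eventually_add_smul_mem_of_mem_intrinsicInterior hx1 ha).and
      (eventually_add_smul_mem_of_mem_intrinsicInterior hx2 (Submodule.neg_mem _ hb))
    obtain ⟨t, ⟨ht1, ht2⟩, ht⟩ := ((hev.filter_mono nhdsWithin_le_nhds).and
      (self_mem_nhdsWithin (s := Set.Ioi (0 : ℝ)))).exists
    refine ⟨t, ht, Set.mem_sub.2 ⟨_, ht1, _, ht2, ?_⟩⟩
    rw [smul_neg, smul_add]
    abel

theorem hasRegularDomDiff_of_interior {F1 F2 : X → Set Y}
    (hc1 : Convex ℝ {p : X × Y | p.2 ∈ F1 p.1})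
    (hint : (interior {p : X × Y | p.2 ∈ F1 p.1}).Nonempty)
    (h : (interior (sdom F1) ∩ sdom F2).Nonempty) : HasRegularDomDiff F1 F2 := by
  obtain ⟨⟨a, b⟩, hab⟩ := hint
  obtain ⟨x0, hx1, y2, hy2⟩ := h
  have hev : ∀ᶠ t : ℝ in nhds 0, x0 + t • (x0 - a) ∈ sdom F1 := by
    have hcont : Continuous fun t : ℝ => x0 + t • (x0 - a) := by fun_prop
    exact hcont.continuousAt.preimage_mem_nhds
      (by simpa using mem_interior_iff_mem_nhds.1 hx1)
  obtain ⟨e, ⟨y, hy⟩, he⟩ := ((hev.filter_mono nhdsWithin_le_nhds).and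
    (self_mem_nhdsWithin (s := Set.Ioi (0 : ℝ)))).exists
  have h1e : 1 + e ≠ 0 := by positivity
  have hmem := hc1.combo_interior_self_mem_interior hab
    (y := (x0 + e • (x0 - a), y)) hy (a := e / (1 + e)) (b := 1 / (1 + e))
    (by positivity) (by positivity) (by field_simp; ring)
  obtain ⟨y0, hy0⟩ : ∃ y0, (x0, y0) ∈ interior {p : X × Y | p.2 ∈ F1 p.1} := by
    have hx0 : (e / (1 + e)) • a + (1 / (1 + e)) • (x0 + e • (x0 - a)) = x0 := by
      match_scalars <;> field_simp
      ring
    rw [Prod.smul_mk, Prod.smul_mk, Prod.mk_add_mk, hx0] at hmem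
    exact ⟨_, hmem⟩
  obtain ⟨r, hr, hball⟩ := Metric.mem_nhds_iff.1 (mem_interior_iff_mem_nhds.1 hy0)
  have hlift : ∀ u : X, ‖u‖ < r → y0 ∈ F1 (x0 + u) := fun u hu => by
    refine @hball (x0 + u, y0) ?_
    rw [Metric.mem_ball, Prod.dist_eq]
    simpa [hr] using hu
  refine ⟨⊤, fun _ _ _ _ => trivial, fun u _ => ?_, Or.inr ⟨r, hr,
    max (‖x0‖ + r + ‖y0‖) (‖(x0, y2)‖), fun u _ hu =>
      ⟨(x0 + u, y0), (x0, y2), hlift u hu, hy2, by simp, le_max_of_le_left ?_, le_max_right _ _⟩⟩⟩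
  · have hpos : 0 < r / (1 + ‖u‖) := by positivity
    refine ⟨r / (1 + ‖u‖), hpos,
      Set.mem_sub.2 ⟨x0 + (r / (1 + ‖u‖)) • u, ⟨y0, hlift _ ?_⟩, x0, ⟨y2, hy2⟩, by simp⟩⟩
    rw [norm_smul, Real.norm_of_nonneg hpos.le, div_mul_eq_mul_div, div_lt_iff₀ (by positivity)]
    linarith
  · have := norm_add_le x0 u
    have := norm_nonneg y0
    have := norm_nonneg x0
    exact max_le (by linarith) (by change ‖y0‖ ≤ _; linarith)

theorem hasRegularDomDiff_of_zeroSqri [CompleteSpace X] [CompleteSpace Y] {F1 F2 : X → Set Y}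
    (hc1 : Convex ℝ {p : X × Y | p.2 ∈ F1 p.1}) (hc2 : Convex ℝ {p : X × Y | p.2 ∈ F2 p.1})
    (hcl1 : IsClosed {p : X × Y | p.2 ∈ F1 p.1}) (hcl2 : IsClosed {p : X × Y | p.2 ∈ F2 p.1})
    (h : ZeroSqri (sdom F1 - sdom F2)) : HasRegularDomDiff F1 F2 := by
  obtain ⟨h0, S, hS, hScl⟩ := h
  have : CompleteSpace S := hScl.completeSpace_coe
  have hmemS : ∀ u, u ∈ S ↔ u ∈ coneGen (sdom F1 - sdom F2) := fun u => Set.ext_iff.1 hS u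
  have hsub : ∀ x ∈ sdom F1, ∀ x' ∈ sdom F2, x - x' ∈ S := fun x hx x' hx' =>
    (hmemS _).2 ⟨1, zero_le_one, _, Set.sub_mem_sub hx hx', (one_smul ℝ _).symm⟩
  let T : (X × Y) × (X × Y) →L[ℝ] X :=
    (ContinuousLinearMap.fst ℝ X Y).comp (ContinuousLinearMap.fst ℝ (X × Y) (X × Y)) -
      (ContinuousLinearMap.fst ℝ X Y).comp (ContinuousLinearMap.snd ℝ (X × Y) (X × Y))
  have hT : ∀ p q : X × Y, T (p, q) = p.1 - q.1 := fun _ _ => rfl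
  let G : Set ((X × Y) × (X × Y)) := {p : X × Y | p.2 ∈ F1 p.1} ×ˢ {p : X × Y | p.2 ∈ F2 p.1}
  have hG : Convex ℝ G := hc1.prod hc2
  have hGT : ∀ z ∈ G, T z ∈ S := fun z hz => hsub _ ⟨_, hz.1⟩ _ ⟨_, hz.2⟩
  have hGex : ∀ a ∈ sdom F1 - sdom F2, ∃ z ∈ G, T z = a := by
    rintro _ ⟨x, ⟨y, hy⟩, x', ⟨y', hy'⟩, rfl⟩
    exact ⟨((x, y), (x', y')), ⟨hy, hy'⟩, rfl⟩
  obtain ⟨z0, hz0, hTz0⟩ := hGex 0 h0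
  let C : Set ((X × Y) × (X × Y)) := (fun z => z0 + z) ⁻¹' G ∩ Metric.closedBall 0 1
  have hTz : ∀ z, T (z0 + z) = T z := fun z => by rw [map_add, hTz0, zero_add]
  obtain ⟨r, hr, hball⟩ := Convex.exists_ball_subset_image T S (C := C)
    ((hG.translate_preimage_right z0).inter (convex_closedBall _ _))
    (((hcl1.prod hcl2).preimage (by fun_prop)).inter Metric.isClosed_closedBall)
    ⟨by simpa using hz0, by simp⟩ (R := 1) (fun z hz => mem_closedBall_zero_iff.1 hz.2)
    (fun z hz => hTz z ▸ hGT _ hz.1) (by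
      intro u hu
      obtain ⟨t, ht, a, ha, rfl⟩ := (hmemS u).1 hu
      obtain ⟨z, hz, rfl⟩ := hGex a ha
      obtain ⟨n, hn⟩ := exists_nat_ge (t * (1 + ‖z - z0‖))
      have hn1 : (0 : ℝ) < (n : ℝ) + 1 := by positivity
      have htd : 0 ≤ t * ‖z - z0‖ := by positivity
      refine ⟨n, (t / ((n : ℝ) + 1)) • (z - z0), ⟨?_, ?_⟩, ?_⟩
      · exact hG.add_smul_sub_mem hz0 hz ⟨by positivity, by rw [div_le_one hn1]; linarith⟩
      · rw [mem_closedBall_zero_iff, norm_smul, Real.norm_of_nonneg (by positivity),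
          div_mul_eq_mul_div, div_le_one hn1]
        linarith
      · rw [map_smul, map_sub, hTz0, sub_zero, smul_smul, mul_div_cancel₀ _ hn1.ne'])
  refine ⟨S, hsub, fun u hu => ?_, Or.inr ⟨r, hr, ‖z0‖ + 1, fun u hu hur => ?_⟩⟩
  · obtain ⟨t, ht, a, ha, rfl⟩ := (hmemS u).1 hu
    rcases ht.eq_or_lt with rfl | ht
    · exact ⟨1, one_pos, by simpa using h0⟩
    · exact ⟨t⁻¹, inv_pos.2 ht, by rwa [smul_smul, inv_mul_cancel₀ ht.ne', one_smul]⟩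
  · obtain ⟨z, hz, rfl⟩ := hball u hu hur
    have hnorm : ‖z0 + z‖ ≤ ‖z0‖ + 1 :=
      (norm_add_le _ _).trans (by gcongr; exact mem_closedBall_zero_iff.1 hz.2)
    exact ⟨(z0 + z).1, (z0 + z).2, hz.1.1, hz.1.2, hTz z, (norm_fst_le _).trans hnorm,
      (norm_snd_le _).trans hnorm⟩

theorem coderiv_add_subset_of_hasRegularDomDiff {F1 F2 : X → Set Y}
    (hc1 : Convex ℝ {p : X × Y | p.2 ∈ F1 p.1}) (hc2 : Convex ℝ {p : X × Y | p.2 ∈ F2 p.1})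
    (hreg : HasRegularDomDiff F1 F2) {xb : X} {yb1 yb2 : Y} (h1 : yb1 ∈ F1 xb)
    (h2 : yb2 ∈ F2 xb) (ys : Y →L[ℝ] ℝ) :
    coderiv (fun x => F1 x + F2 x) xb (yb1 + yb2) ys ⊆
      coderiv F1 xb yb1 ys + coderiv F2 xb yb2 ys := by
  intro xs hxs
  obtain ⟨S, hsub, habs, hS⟩ := hreg
  let height : X × Y → X × Y → ℝ := fun p q =>
    ys (p.2 - yb1) + ys (q.2 - yb2) - xs (q.1 - xb)
  let A : Set (X × ℝ) := {w | ∃ p q : X × Y, p.2 ∈ F1 p.1 ∧ q.2 ∈ F2 q.1 ∧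
    w = (p.1 - q.1, height p q)}
  have hA : Convex ℝ A := by
    rintro _ ⟨p, q, hp, hq, rfl⟩ _ ⟨p', q', hp', hq', rfl⟩ a b ha hb hab
    refine ⟨a • p + b • p', a • q + b • q', hc1 hp hp' ha hb hab, hc2 hq hq' ha hb hab,
      Prod.ext ?_ ?_⟩
    · simp only [Prod.fst_add, Prod.smul_fst]
      module
    · simp only [height, Prod.fst_add, Prod.smul_fst, Prod.snd_add, Prod.smul_snd, map_sub,
        map_add, map_smul, smul_eq_mul]
      linear_combination (xs xb - ys yb1 - ys yb2) * hab
  obtain ⟨g, hg⟩ := exists_continuousLinearMap_le_of_convex hA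
    ⟨(xb, yb1), (xb, yb2), h1, h2, by simp [height]⟩
    (by
      rintro s ⟨p, q, hp, hq, hpq⟩
      obtain ⟨hx, rfl⟩ := Prod.mk.inj hpq
      have hx' : q.1 = p.1 := (sub_eq_zero.1 hx.symm).symm
      have := hxs (q.1, p.2 + q.2) (Set.add_mem_add (hx' ▸ hp) hq)
      simp only [map_sub, map_add] at this
      simp only [height, map_sub]
      linarith)
    S (by
      rintro _ ⟨p, q, hp, hq, rfl⟩
      exact hsub _ ⟨_, hp⟩ _ ⟨_, hq⟩)
    (fun u hu => by
      obtain ⟨t, ht, x, ⟨y, hy⟩, x', ⟨y', hy'⟩, hxx⟩ := habs u hu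
      exact ⟨t, ht, _, (x, y), (x', y'), hy, hy', Prod.ext hxx.symm rfl⟩)
    (hS.imp_right fun ⟨r, hr, M, h⟩ => by
      refine ⟨r, hr, ‖ys‖ * (M + ‖yb1‖) + ‖ys‖ * (M + ‖yb2‖) + ‖xs‖ * (M + ‖xb‖),
        fun u hu hur => ?_⟩
      obtain ⟨p, q, hp, hq, rfl, hpM, hqM⟩ := h u hu hur
      refine ⟨_, ?_, p, q, hp, hq, rfl⟩
      have e1 : ys (p.2 - yb1) ≤ ‖ys‖ * (M + ‖yb1‖) := (le_abs_self _).trans <|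
        ys.le_opNorm_of_le ((norm_sub_le _ _).trans (by gcongr; exact (norm_snd_le p).trans hpM))
      have e2 : ys (q.2 - yb2) ≤ ‖ys‖ * (M + ‖yb2‖) := (le_abs_self _).trans <|
        ys.le_opNorm_of_le ((norm_sub_le _ _).trans (by gcongr; exact (norm_snd_le q).trans hqM))
      have e3 : -xs (q.1 - xb) ≤ ‖xs‖ * (M + ‖xb‖) := (neg_le_abs _).trans <|
        xs.le_opNorm_of_le ((norm_sub_le _ _).trans (by gcongr; exact (norm_fst_le q).trans hqM))
      simp only [height]
      linarith)
  refine Set.mem_add.2 ⟨g, fun p hp => ?_, xs - g, fun q hq => ?_, add_sub_cancel _ _⟩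
  · have := hg _ ⟨p, (xb, yb2), hp, h2, rfl⟩
    simp only [height, sub_self, map_zero] at this
    linarith
  · have := hg _ ⟨(xb, yb1), q, h1, hq, rfl⟩
    simp only [height, sub_self, map_zero] at this
    rw [sub_apply]
    have hneg : g (xb - q.1) = -g (q.1 - xb) := by rw [← map_neg, neg_sub]
    linarith

theorem coderiv_add_coderiv_subset (F1 F2 : X → Set Y) (xb : X) (yb1 yb2 : Y)
    (ys : Y →L[ℝ] ℝ) :
    coderiv F1 xb yb1 ys + coderiv F2 xb yb2 ys ⊆
      coderiv (fun x => F1 x + F2 x) xb (yb1 + yb2) ys := by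
  rintro _ ⟨x1, hx1, x2, hx2, rfl⟩ ⟨x, _⟩ ⟨y1, hy1, y2, hy2, rfl⟩
  have e1 := hx1 (x, y1) hy1
  have e2 := hx2 (x, y2) hy2
  simp only [map_sub, map_add, add_apply] at e1 e2 ⊢
  linarith

/-- Coderivative sum rule for convex set-valued mappings: under a qualification
condition, `D*(F₁+F₂)(xb, yb)(y*) = D*F₁(xb, yb₁)(y*) + D*F₂(xb, yb₂)(y*)` whenever
`yb₁ ∈ F₁(xb)`, `yb₂ ∈ F₂(xb)` and `yb = yb₁ + yb₂`. -/
theorem coderiv_sum_rule (F1 F2 : X → Set Y)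
    (hc1 : Convex ℝ {p : X × Y | p.2 ∈ F1 p.1})
    (hc2 : Convex ℝ {p : X × Y | p.2 ∈ F2 p.1})
    (hqc : (FiniteDimensional ℝ X ∧ FiniteDimensional ℝ Y ∧
        (intrinsicInterior ℝ (sdom F1) ∩ intrinsicInterior ℝ (sdom F2)).Nonempty) ∨
      ((interior {p : X × Y | p.2 ∈ F1 p.1}).Nonempty ∧
        (interior (sdom F1) ∩ sdom F2).Nonempty) ∨
      (CompleteSpace X ∧ CompleteSpace Y ∧
        IsClosed {p : X × Y | p.2 ∈ F1 p.1} ∧ IsClosed {p : X × Y | p.2 ∈ F2 p.1} ∧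
        ZeroSqri (sdom F1 - sdom F2)))
    (xb : X) (yb yb1 yb2 : Y) (h1 : yb1 ∈ F1 xb) (h2 : yb2 ∈ F2 xb)
    (hsum : yb = yb1 + yb2) (ys : Y →L[ℝ] ℝ) :
    coderiv (fun x => F1 x + F2 x) xb yb ys =
      coderiv F1 xb yb1 ys + coderiv F2 xb yb2 ys := by
  subst hsum
  have hreg : HasRegularDomDiff F1 F2 := by
    rcases hqc with ⟨_, -, h⟩ | ⟨hint, h⟩ | ⟨_, _, hcl1, hcl2, h⟩
    · exact hasRegularDomDiff_of_intrinsicInterior h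
    · exact hasRegularDomDiff_of_interior hc1 hint h
    · exact hasRegularDomDiff_of_zeroSqri hc1 hc2 hcl1 hcl2 h
  exact (coderiv_add_subset_of_hasRegularDomDiff hc1 hc2 hreg h1 h2 ys).antisymm
    (coderiv_add_coderiv_subset F1 F2 xb yb1 yb2 ys)

end
end
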